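/- arXiv:2209.15630 — 2 statements merged into one kernel-verified Lean document; each statement's English description precedes it below -/
import Mathlib

section
/- Let R be a commutative noetherian local ring and A a Noether R-algebra. Let M be a nonzero finitely generated right A-module. Then the injective dimension of M as a right A-module equals the supremum of the set { i : Ext^i_A(A/rad A, M) ≠ 0 } (an equality in ℕ ∪ {∞}). -/
open CategoryTheory

universe u

/-- The Jacobson radical `rad A` (the intersection of the maximal left ideals of `A`,
a two-sided ideal), viewed as a submodule of the right regular module `A`
(formalized as the left regular `Aᵐᵒᵖ`-module). -/
def radRight (A : Type u) [Ring A] : Submodule Aᵐᵒᵖ Aᵐᵒᵖ where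
  carrier := {x | x.unop ∈ TwoSidedIdeal.jacobson (⊥ : TwoSidedIdeal A)}
  add_mem' := by
    intro x y hx hy
    simp only [Set.mem_setOf_eq, MulOpposite.unop_add] at *
    exact TwoSidedIdeal.add_mem _ hx hy
  zero_mem' := by
    simp only [Set.mem_setOf_eq, MulOpposite.unop_zero]
    exact TwoSidedIdeal.zero_mem _
  smul_mem' := by
    intro c x hx
    simp only [Set.mem_setOf_eq] at *
    exact (TwoSidedIdeal.jacobson (⊥ : TwoSidedIdeal A)).mul_mem_right _ _ hx

/-- `A/rad A`, regarded as a right `A`-module (i.e. a left `Aᵐᵒᵖ`-module). -/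
abbrev modRad (A : Type u) [Ring A] := Aᵐᵒᵖ ⧸ radRight A

/-- `Ext^n` in the category of modules over a ring `B`; taking `B = Aᵐᵒᵖ` gives the
Ext groups of right `A`-modules. -/
noncomputable abbrev extGrp (B : Type u) [Ring B] (n : ℕ) (X Y : ModuleCat.{u} B) :
    ModuleCat ℤ :=
  ((Ext ℤ (ModuleCat.{u} B) n).obj (Opposite.op X)).obj Y

/-- The injective dimension of a module, as an element of `ℕ∞`: the least `d` such that
`Ext^i(N, M) = 0` for all `i > d` and all modules `N` (the standard characterization of the
least length of an injective resolution of `M`), and `∞` if there is no such `d`. -/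
noncomputable def injDim (B : Type u) [Ring B] (M : ModuleCat.{u} B) : ℕ∞ :=
  sInf {d : ℕ∞ | ∀ i : ℕ, d < (i : ℕ∞) → ∀ N : ModuleCat.{u} B, Subsingleton (extGrp B i N M)}

section ExtComparison

variable {C : Type*} [Category* C] [Abelian C] [EnoughProjectives C] [HasExt.{u} C]

/-- In positive degrees, both constructions of `Ext` vanish exactly when every cocycle of the
complex `Hom(P, Y)` attached to a projective resolution `P` of `X` is a coboundary. -/
theorem subsingleton_leftDerivedExt_iff (X Y : C) {i : ℕ} (hi : i ≠ 0) :
    Subsingleton (((Ext ℤ C i).obj (Opposite.op X)).obj Y) ↔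
      Subsingleton (Abelian.Ext.{u} X Y i) := by
  obtain ⟨j, rfl⟩ := Nat.exists_eq_succ_of_ne_zero hi
  let P := ProjectiveResolution.of X
  have h₁ : Subsingleton (((Ext ℤ C (j + 1)).obj (Opposite.op X)).obj Y) ↔
      ∀ f : P.complex.X (j + 1) ⟶ Y, P.complex.d (j + 2) (j + 1) ≫ f = 0 →
        ∃ g : P.complex.X j ⟶ Y, P.complex.d (j + 1) j ≫ g = f := by
    rw [← ModuleCat.isZero_iff_subsingleton, (P.isoExt (j + 1) Y).isZero_iff,
      ← HomologicalComplex.exactAt_iff_isZero_homology,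
      HomologicalComplex.exactAt_iff' _ j (j + 1) (j + 2) (by simp) (by simp),
      ShortComplex.moduleCat_exact_iff]
    rfl
  have h₂ : Subsingleton (Abelian.Ext.{u} X Y (j + 1)) ↔
      ∀ f : P.complex.X (j + 1) ⟶ Y, P.complex.d (j + 2) (j + 1) ≫ f = 0 →
        ∃ g : P.complex.X j ⟶ Y, P.complex.d (j + 1) j ≫ g = f := by
    constructor
    · intro _ f hf
      exact (P.extMk_eq_zero_iff f (j + 2) rfl hf j rfl).1 (Subsingleton.elim _ _)
    · refine fun h ↦ subsingleton_of_forall_eq 0 fun α ↦ ?_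
      obtain ⟨f, hf, rfl⟩ := P.extMk_surjective α (j + 2) rfl
      exact (P.extMk_eq_zero_iff f (j + 2) rfl hf j rfl).2 (h f hf)
  rw [h₁, h₂]

end ExtComparison

open Abelian in
/-- If `Ext¹(B ⧸ I, M)` vanishes for every left ideal `I`, then `M` is injective. -/
theorem injective_of_subsingleton_ext_one_quotient {B : Type u} [Ring B] (M : ModuleCat.{u} B)
    (h : ∀ I : Ideal B, Subsingleton (Abelian.Ext.{u} (ModuleCat.of B (B ⧸ I)) M 1)) :
    Injective M := by
  rw [← Module.injective_iff_injective_object, ← Module.Baer.iff_injective]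
  intro I g
  let S : ShortComplex (ModuleCat.{u} B) := ShortComplex.mk (ModuleCat.ofHom I.subtype)
    (ModuleCat.ofHom I.mkQ) (by ext x; simp)
  have hS : S.ShortExact := ModuleCat.shortComplex_shortExact S
    (LinearMap.exact_subtype_mkQ I) I.injective_subtype I.mkQ_surjective
  obtain ⟨x, hx⟩ := Ext.contravariant_sequence_exact₁ hS M
    (Ext.mk₀ (ModuleCat.ofHom g : S.X₁ ⟶ M)) (add_zero 1) ((h I).elim _ _)
  obtain ⟨k, rfl⟩ := Ext.homEquiv₀.symm.surjective x
  simp only [Ext.homEquiv₀_symm_apply, Ext.mk₀_comp_mk₀] at hx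
  have hk : S.f ≫ k = ModuleCat.ofHom g := Ext.homEquiv₀.symm.injective hx
  refine ⟨k.hom, fun x hx ↦ ?_⟩
  exact LinearMap.congr_fun (congrArg ModuleCat.Hom.hom hk) ⟨x, hx⟩

open Abelian in
/-- A version of Baer's criterion for the injective dimension. -/
theorem hasInjectiveDimensionLT_of_subsingleton_ext_quotient {B : Type u} [Ring B]
    (M : ModuleCat.{u} B) (n : ℕ) (h : ∀ I : Ideal B,
      Subsingleton (Abelian.Ext.{u} (ModuleCat.of B (B ⧸ I)) M (n + 1))) :
    HasInjectiveDimensionLT M (n + 1) := by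
  induction n generalizing M with
  | zero =>
    have := injective_of_subsingleton_ext_one_quotient M h
    infer_instance
  | succ n ih =>
    let T := ShortComplex.mk (Injective.ι M) (Limits.cokernel.π (Injective.ι M))
      (Limits.cokernel.condition _)
    have hT : T.ShortExact := { exact := ShortComplex.exact_cokernel _ }
    refine (hT.hasInjectiveDimensionLT_X₃_iff n (inferInstanceAs (Injective (Injective.under M)))).1
      (ih T.X₃ fun I ↦ subsingleton_of_forall_eq 0 fun e ↦ ?_)
    obtain ⟨y, rfl⟩ := Ext.covariant_sequence_exact₃ _ hT e rfl ((h I).elim _ _)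
    have : Injective T.X₂ := inferInstanceAs (Injective (Injective.under M))
    rw [Ext.eq_zero_of_injective y, Ext.zero_comp]

section NoetherAlgebra

open Abelian ModuleCat.Algebra

theorem subsingleton_ext_of_shortExact {B : Type u} [Ring B] {S : ShortComplex (ModuleCat.{u} B)}
    (hS : S.ShortExact) (M : ModuleCat.{u} B) (i : ℕ)
    (h₁ : Subsingleton (Abelian.Ext.{u} S.X₁ M i)) (h₃ : Subsingleton (Abelian.Ext.{u} S.X₃ M i)) :
    Subsingleton (Abelian.Ext.{u} S.X₂ M i) := by
  refine subsingleton_of_forall_eq 0 fun e ↦ ?_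
  obtain ⟨y, rfl⟩ := Ext.contravariant_sequence_exact₂ hS M e (h₁.elim _ _)
  rw [h₃.elim y 0, Ext.comp_zero]

theorem subsingleton_ext_of_submodule_of_quotient {B : Type u} [Ring B] {N : Type u}
    [AddCommGroup N] [Module B N] (K : Submodule B N) (M : ModuleCat.{u} B) (i : ℕ)
    (h₁ : Subsingleton (Abelian.Ext.{u} (ModuleCat.of B K) M i))
    (h₃ : Subsingleton (Abelian.Ext.{u} (ModuleCat.of B (N ⧸ K)) M i)) :
    Subsingleton (Abelian.Ext.{u} (ModuleCat.of B N) M i) := by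
  let S : ShortComplex (ModuleCat.{u} B) := ShortComplex.mk (ModuleCat.ofHom K.subtype)
    (ModuleCat.ofHom K.mkQ) (by ext x; simp)
  have hS : S.ShortExact := ModuleCat.shortComplex_shortExact S
    (LinearMap.exact_subtype_mkQ K) K.injective_subtype K.mkQ_surjective
  exact subsingleton_ext_of_shortExact hS M i h₁ h₃

theorem subsingleton_ext_of_subsingleton {B : Type u} [Ring B] (N : Type u)
    [AddCommGroup N] [Module B N] [Subsingleton N] (M : ModuleCat.{u} B) (i : ℕ) :
    Subsingleton (Abelian.Ext.{u} (ModuleCat.of B N) M i) := by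
  refine subsingleton_of_forall_eq 0 fun e ↦ ?_
  rw [← e.mk₀_id_comp, (ModuleCat.isZero_of_subsingleton (ModuleCat.of B N)).eq_of_src (𝟙 _) 0,
    Ext.mk₀_zero, Ext.zero_comp]

theorem subsingleton_ext_of_leftInverse {B : Type u} [Ring B] {N P : Type u}
    [AddCommGroup N] [Module B N] [AddCommGroup P] [Module B P] (s : N →ₗ[B] P) (p : P →ₗ[B] N)
    (hsp : p ∘ₗ s = LinearMap.id) (M : ModuleCat.{u} B) (i : ℕ)
    (h : Subsingleton (Abelian.Ext.{u} (ModuleCat.of B P) M i)) :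
    Subsingleton (Abelian.Ext.{u} (ModuleCat.of B N) M i) := by
  refine subsingleton_of_forall_eq 0 fun e ↦ ?_
  have hid : ModuleCat.ofHom s ≫ ModuleCat.ofHom p = 𝟙 (ModuleCat.of B N) := by
    rw [← ModuleCat.ofHom_comp, hsp]
    rfl
  rw [← e.mk₀_id_comp, ← hid, ← Ext.mk₀_comp_mk₀_assoc,
    h.elim ((Ext.mk₀ (ModuleCat.ofHom p)).comp e (zero_add i)) 0, Ext.comp_zero]

/-- Over a finite algebra `B` over a commutative noetherian ring `R`, the `R`-modules `Ext` between
finitely generated `B`-modules are finitely generated. -/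
theorem finite_ext_of_finite_algebra (R : Type u) [CommRing R] [IsNoetherianRing R]
    {B : Type u} [Ring B] [Algebra R B] [Module.Finite R B] (N M : ModuleCat.{u} B)
    [Module.Finite B N] [Module.Finite B M] (i : ℕ) :
    Module.Finite R (Abelian.Ext.{u} N M i) := by
  have : IsNoetherianRing B := isNoetherian_of_tower R inferInstance
  induction i generalizing N with
  | zero =>
    have : Module.Finite R N := Module.Finite.trans B N
    have : Module.Finite R M := Module.Finite.trans B M
    let φ : (N ⟶ M) →ₗ[R] (N →ₗ[R] M) :=
      { toFun f := f.hom.restrictScalars R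
        map_add' _ _ := rfl
        map_smul' _ _ := rfl }
    have hφ : Function.Injective φ := fun f g h ↦ by
      ext x
      exact LinearMap.congr_fun h x
    have := Module.Finite.of_injective φ hφ
    exact Module.Finite.equiv (Ext.linearEquiv₀ (R := R) (X := N) (Y := M)).symm
  | succ n ih =>
    obtain ⟨k, f, hf⟩ := Module.Finite.exists_fin' B N
    let hS := LinearMap.shortExact_shortComplexKer hf
    have : Module.Finite B f.shortComplexKer.X₁ := inferInstanceAs (Module.Finite B f.ker)
    have : Projective f.shortComplexKer.X₂ :=
      inferInstanceAs (Projective (ModuleCat.of B (Fin k → B)))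
    have := ih (f.shortComplexKer.X₁)
    exact Module.Finite.of_surjective (hS.extClass.precompOfLinear R M (add_comm 1 n))
      (precomp_extClass_surjective_of_projective_X₂ M hS n)

/-- Multiplication by an element of the base ring, as an endomorphism of a module over an
algebra. -/
def algebraMapEnd {R : Type*} [CommRing R] (B : Type*) [Ring B] [Algebra R B] (N : Type*)
    [AddCommGroup N] [Module B N] (x : R) : N →ₗ[B] N where
  toFun n := algebraMap R B x • n
  map_add' := smul_add _
  map_smul' b n := by simp only [smul_smul, Algebra.commutes, RingHom.id_apply]

@[simp]
theorem algebraMapEnd_apply {R : Type*} [CommRing R] (B : Type*) [Ring B] [Algebra R B] (N : Type*)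
    [AddCommGroup N] [Module B N] (x : R) (n : N) :
    algebraMapEnd B N x n = algebraMap R B x • n := rfl

/-- If `x` lies in the maximal ideal of `R`, acts injectively on `N`, and `Ext` in degree `i + 1`
from `N ⧸ x N` vanishes, then `Ext` in degree `i` from `N` vanishes. -/
theorem subsingleton_ext_of_injective_smul {R : Type u} [CommRing R] [IsNoetherianRing R]
    [IsLocalRing R] {B : Type u} [Ring B] [Algebra R B] [Module.Finite R B] (N : Type u)
    [AddCommGroup N] [Module B N] [Module.Finite B N] (M : ModuleCat.{u} B)
    [Module.Finite B M] (i : ℕ) {x : R} (hx : x ∈ IsLocalRing.maximalIdeal R)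
    (hinj : Function.Injective (algebraMapEnd B N x))
    (h : Subsingleton (Abelian.Ext.{u}
      (ModuleCat.of B (N ⧸ (algebraMapEnd B N x).range)) M (i + 1))) :
    Subsingleton (Abelian.Ext.{u} (ModuleCat.of B N) M i) := by
  have := finite_ext_of_finite_algebra R (ModuleCat.of B N) M i
  let f := algebraMapEnd B N x
  let S : ShortComplex (ModuleCat.{u} B) :=
    ModuleCat.shortComplexOfCompEqZero _ _ f.exact_map_mkQ_range.linearMap_comp_eq_zero
  have hS : S.ShortExact := ModuleCat.shortComplex_shortExact S
    f.exact_map_mkQ_range hinj (Submodule.mkQ_surjective _)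
  have hf : S.f = x • 𝟙 (ModuleCat.of B N) := rfl
  rw [← Submodule.subsingleton_iff R, ← subsingleton_iff_bot_eq_top, eq_comm]
  refine Submodule.eq_bot_of_le_smul_of_le_jacobson_bot (Ideal.span {x}) _
    Module.Finite.fg_top (fun e _ ↦ ?_) ?_
  · obtain ⟨y, rfl⟩ := Ext.contravariant_sequence_exact₁ hS M e (add_comm 1 i) (h.elim _ _)
    rw [hf, Ext.mk₀_smul, Ext.smul_comp, Ext.mk₀_id_comp]
    exact Submodule.smul_mem_smul (Ideal.mem_span_singleton_self x) trivial
  · rw [Ideal.span_singleton_le_iff_mem, IsLocalRing.jacobson_eq_maximalIdeal _ bot_ne_top]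
    exact hx

theorem subsingleton_ext_of_pow_smul_eq_zero {R : Type u} [CommRing R] {B : Type u} [Ring B]
    [Algebra R B] [IsNoetherianRing B] (M : ModuleCat.{u} B) (i : ℕ) (I : Ideal R) (x : R)
    (h : ∀ (N : Type u) [AddCommGroup N] [Module B N] [Module.Finite B N],
      (∀ a ∈ I ⊔ Ideal.span {x}, ∀ v : N, algebraMap R B a • v = 0) →
        Subsingleton (Abelian.Ext.{u} (ModuleCat.of B N) M i))
    (N : Type u) [AddCommGroup N] [Module B N] [Module.Finite B N]
    (hI : ∀ a ∈ I, ∀ v : N, algebraMap R B a • v = 0) (k : ℕ)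
    (hk : ∀ v : N, algebraMap R B x ^ k • v = 0) :
    Subsingleton (Abelian.Ext.{u} (ModuleCat.of B N) M i) := by
  induction k generalizing N with
  | zero =>
    have : Subsingleton N := subsingleton_of_forall_eq 0 fun v ↦ by simpa using hk v
    exact subsingleton_ext_of_subsingleton N M i
  | succ k ih =>
    refine subsingleton_ext_of_submodule_of_quotient (algebraMapEnd B N x).ker M i
      (h _ fun a ha v ↦ ?_) (ih _ (fun a ha v ↦ ?_) fun v ↦ ?_)
    · obtain ⟨b, hb, c, hc, rfl⟩ := Submodule.mem_sup.1 ha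
      obtain ⟨d, rfl⟩ := Ideal.mem_span_singleton'.1 hc
      have hv : algebraMap R B x • (v : N) = 0 := v.2
      ext
      simp [add_smul, mul_smul, hI b hb, hv]
    · obtain ⟨v, rfl⟩ := Submodule.mkQ_surjective _ v
      rw [← map_smul, hI a ha, map_zero]
    · obtain ⟨v, rfl⟩ := Submodule.mkQ_surjective _ v
      rw [← map_smul, Submodule.mkQ_apply, Submodule.Quotient.mk_eq_zero, LinearMap.mem_ker,
        algebraMapEnd_apply, smul_smul, ← pow_succ', hk]

/-- If `Ext` in all degrees `> n` vanishes on the finitely generated modules killed by the maximal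
ideal of `R`, then it vanishes on all finitely generated modules. -/
theorem subsingleton_ext_of_maximalIdeal {R : Type u} [CommRing R] [IsNoetherianRing R]
    [IsLocalRing R] {B : Type u} [Ring B] [Algebra R B] [Module.Finite R B]
    (M : ModuleCat.{u} B) [Module.Finite B M] (n : ℕ)
    (h : ∀ (N : Type u) [AddCommGroup N] [Module B N] [Module.Finite B N],
      (∀ a ∈ IsLocalRing.maximalIdeal R, ∀ v : N, algebraMap R B a • v = 0) → ∀ i, n < i →
        Subsingleton (Abelian.Ext.{u} (ModuleCat.of B N) M i))
    (N : Type u) [AddCommGroup N] [Module B N] [Module.Finite B N] (i : ℕ) (hi : n < i) :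
    Subsingleton (Abelian.Ext.{u} (ModuleCat.of B N) M i) := by
  have : IsNoetherianRing B := isNoetherian_of_tower R inferInstance
  suffices ∀ (I : Ideal R) (N : Type u) [AddCommGroup N] [Module B N] [Module.Finite B N],
      (∀ a ∈ I, ∀ v : N, algebraMap R B a • v = 0) → ∀ i, n < i →
        Subsingleton (Abelian.Ext.{u} (ModuleCat.of B N) M i) from
    this ⊥ N (fun a ha v ↦ by simp [(Submodule.mem_bot R).1 ha]) i hi
  intro I
  induction I using WellFoundedGT.induction with
  | ind I ih =>
  intro N _ _ _ hI i hi
  by_cases hm : IsLocalRing.maximalIdeal R ≤ I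
  · exact h N (fun a ha ↦ hI a (hm ha)) i hi
  obtain ⟨x, hxm, hxI⟩ := SetLike.not_le_iff_exists.1 hm
  have hlt : I < I ⊔ Ideal.span {x} := by
    simpa [left_lt_sup, Ideal.span_singleton_le_iff_mem] using hxI
  obtain ⟨k, hk⟩ := monotone_stabilizes_iff_noetherian.2 (inferInstanceAs (IsNoetherian B N))
    (algebraMapEnd B N x).iterateKer
  have hpow (k : ℕ) (v : N) : (algebraMapEnd B N x ^ k) v = algebraMap R B x ^ k • v := by
    induction k with
    | zero => simp
    | succ k ih =>
      rw [pow_succ', Module.End.mul_apply, ih, algebraMapEnd_apply, smul_smul, pow_succ']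
  have hker (k : ℕ) (v : N) :
      v ∈ (algebraMapEnd B N x).iterateKer k ↔ algebraMap R B x ^ k • v = 0 := by
    rw [← hpow]
    rfl
  let K : Submodule B N := (algebraMapEnd B N x).iterateKer k
  refine subsingleton_ext_of_submodule_of_quotient K M i
    (subsingleton_ext_of_pow_smul_eq_zero M i I x (fun N _ _ _ hN ↦ ih _ hlt N hN i hi) K
      (fun a ha v ↦ Subtype.ext (hI a ha v)) k fun v ↦ Subtype.ext ((hker k v).1 v.2))
    (subsingleton_ext_of_injective_smul (N ⧸ K) M i hxm ?_ ?_)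
  · rw [injective_iff_map_eq_zero]
    intro v hv
    obtain ⟨v, rfl⟩ := K.mkQ_surjective v
    rw [algebraMapEnd_apply, ← map_smul, Submodule.mkQ_apply, Submodule.Quotient.mk_eq_zero,
      hker, smul_smul, ← pow_succ, ← hker, ← hk (k + 1) (Nat.le_succ k)] at hv
    rwa [Submodule.mkQ_apply, Submodule.Quotient.mk_eq_zero]
  · refine ih _ hlt _ (fun a ha v ↦ ?_) (i + 1) (by lia)
    obtain ⟨v, rfl⟩ := Submodule.mkQ_surjective _ v
    obtain ⟨w, rfl⟩ := K.mkQ_surjective v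
    obtain ⟨b, hb, c, hc, rfl⟩ := Submodule.mem_sup.1 ha
    obtain ⟨d, rfl⟩ := Ideal.mem_span_singleton'.1 hc
    rw [map_add, add_smul, ← map_smul, ← map_smul, hI b hb, map_zero, map_zero, zero_add,
      ← map_smul, Submodule.mkQ_apply, Submodule.Quotient.mk_eq_zero, mul_comm, map_mul, mul_smul]
    exact ⟨_, rfl⟩

end NoetherAlgebra

section Radical

theorem isUnit_one_add_mul_swap {A : Type*} [Ring A] {x y : A} (h : IsUnit (1 + x * y)) :
    IsUnit (1 + y * x) := by
  obtain ⟨u, hu⟩ := h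
  have h₁ : (1 + x * y) * ↑u⁻¹ = 1 := by rw [← hu, Units.mul_inv]
  have h₂ : ↑u⁻¹ * (1 + x * y) = 1 := by rw [← hu, Units.inv_mul]
  refine ⟨⟨1 + y * x, 1 - y * ↑u⁻¹ * x, ?_, ?_⟩, rfl⟩
  · calc _ = 1 + y * x - y * ((1 + x * y) * ↑u⁻¹) * x := by noncomm_ring
      _ = 1 := by rw [h₁]; noncomm_ring
  · calc _ = 1 + y * x - y * (↑u⁻¹ * (1 + x * y)) * x := by noncomm_ring
      _ = 1 := by rw [h₂]; noncomm_ring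

theorem mem_ringJacobson_iff_isUnit {A : Type*} [Ring A] {x : A} :
    x ∈ Ring.jacobson A ↔ ∀ y, IsUnit (1 + y * x) := by
  rw [← Ideal.jacobson_bot]
  have key {x : A} (hx : x ∈ Ideal.jacobson (⊥ : Ideal A)) : ∃ z, z * (1 + x) = 1 := by
    obtain ⟨z, hz⟩ := Ideal.exists_mul_add_sub_mem_of_mem_jacobson x hx
    exact ⟨z, by rwa [Ideal.mem_bot, sub_eq_zero, add_comm] at hz⟩
  refine ⟨fun hx y ↦ ?_, fun h ↦ Ideal.mem_jacobson_iff.2 fun y ↦ ?_⟩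
  · have hyx := Ideal.mul_mem_left _ y hx
    obtain ⟨z, hz⟩ := key hyx
    obtain ⟨w, hw⟩ := key (x := -(z * (y * x))) (neg_mem (Ideal.mul_mem_left _ z hyx))
    rw [← sub_eq_add_neg, show 1 - z * (y * x) = z by
      rw [sub_eq_iff_eq_add, ← hz, mul_add, mul_one]] at hw
    have hwe : w = 1 + y * x := left_inv_eq_right_inv hw hz
    exact ⟨⟨1 + y * x, z, hwe ▸ hw, hz⟩, rfl⟩
  · obtain ⟨u, hu⟩ := h y
    refine ⟨↑u⁻¹, ?_⟩
    rw [Ideal.mem_bot, sub_eq_zero, mul_assoc, ← mul_add_one, add_comm, ← hu, Units.inv_mul]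

theorem op_mem_ringJacobson_iff {A : Type*} [Ring A] {x : Aᵐᵒᵖ} :
    x ∈ Ring.jacobson Aᵐᵒᵖ ↔ x.unop ∈ Ring.jacobson A := by
  simp_rw [mem_ringJacobson_iff_isUnit]
  refine ⟨fun h y ↦ isUnit_one_add_mul_swap ?_, fun h y ↦ isUnit_one_add_mul_swap ?_⟩
  · simpa using (h (MulOpposite.op y)).unop
  · simpa using (h y.unop).op

theorem radRight_eq_ringJacobson (A : Type u) [Ring A] : radRight A = Ring.jacobson Aᵐᵒᵖ := by
  ext x
  rw [op_mem_ringJacobson_iff, ← Ideal.jacobson_bot, Ideal.mem_jacobson_iff]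
  exact TwoSidedIdeal.mem_jacobson_iff

end Radical

section Artinian

variable {R : Type*} [CommRing R] [IsLocalRing R]

theorem algebraMap_mem_ringJacobson {B : Type*} [Ring B] [Algebra R B] [Module.Finite R B] {a : R}
    (ha : a ∈ IsLocalRing.maximalIdeal R) : algebraMap R B a ∈ Ring.jacobson B := by
  rw [← Ideal.jacobson_bot, Ideal.mem_jacobson_iff]
  intro y
  let I : Ideal B := Ideal.span {y * algebraMap R B a + 1}
  have hI : ⊤ ≤ I.restrictScalars R := by
    refine Submodule.le_of_le_smul_of_le_jacobson_bot (I := IsLocalRing.maximalIdeal R)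
      Module.Finite.fg_top (IsLocalRing.maximalIdeal_le_jacobson _) fun c _ ↦ ?_
    rw [show c = c * (y * algebraMap R B a + 1) + a • (-(c * y)) by
      rw [Algebra.smul_def, Algebra.commutes]; noncomm_ring]
    exact Submodule.add_mem_sup (I.mul_mem_left c (Ideal.mem_span_singleton_self _))
      (Submodule.smul_mem_smul ha trivial)
  obtain ⟨z, hz⟩ := Ideal.mem_span_singleton'.1 (hI (Submodule.mem_top (x := 1)))
  refine ⟨z, ?_⟩
  rw [Ideal.mem_bot, sub_eq_zero, mul_assoc, ← mul_add_one, hz]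

theorem isArtinian_of_maximalIdeal_smul_eq_zero (N : Type*) [AddCommGroup N] [Module R N]
    [Module.Finite R N] (h : ∀ a ∈ IsLocalRing.maximalIdeal R, ∀ v : N, a • v = 0) :
    IsArtinian R N := by
  have hN : Module.IsTorsionBySet R N (IsLocalRing.maximalIdeal R) := fun v a ↦ h a a.2 v
  let := Ideal.Quotient.field (IsLocalRing.maximalIdeal R)
  let := hN.module
  have : IsSemisimpleModule R N := hN.isSemisimpleModule_iff.1 inferInstance
  infer_instance

/-- A finitely generated module over a finite `R`-algebra killed by the maximal ideal of the local
ring `R` is artinian. -/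
theorem isArtinian_of_algebraMap_maximalIdeal_smul_eq_zero {B : Type*} [Ring B] [Algebra R B]
    [Module.Finite R B] (N : Type*) [AddCommGroup N] [Module B N] [Module.Finite B N]
    (h : ∀ a ∈ IsLocalRing.maximalIdeal R, ∀ v : N, algebraMap R B a • v = 0) :
    IsArtinian B N := by
  let := Module.compHom N (algebraMap R B)
  have : IsScalarTower R B N := .of_algebraMap_smul fun _ _ ↦ rfl
  have : Module.Finite R N := .trans B N
  have := isArtinian_of_maximalIdeal_smul_eq_zero N h
  exact isArtinian_of_tower R this

theorem isSemisimpleModule_quotient_ringJacobson (R : Type*) [CommRing R] [IsLocalRing R]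
    (B : Type*) [Ring B] [Algebra R B] [Module.Finite R B] :
    IsSemisimpleModule B (B ⧸ Ring.jacobson B) := by
  have : IsArtinian B (B ⧸ Ring.jacobson B) := by
    refine isArtinian_of_algebraMap_maximalIdeal_smul_eq_zero (R := R) _ fun a ha v ↦ ?_
    obtain ⟨v, rfl⟩ := Submodule.mkQ_surjective _ v
    rw [← map_smul, Submodule.mkQ_apply, Submodule.Quotient.mk_eq_zero, smul_eq_mul]
    exact Ideal.mul_mem_right _ _ (algebraMap_mem_ringJacobson ha)
  exact (IsArtinian.isSemisimpleModule_iff_jacobson B _).2 (Module.jacobson_quotient_jacobson B B)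

end Artinian

section ExtSimple

variable {B : Type u} [Ring B] (M : ModuleCat.{u} B) (i : ℕ)

theorem subsingleton_ext_of_isSimpleModule [IsSemisimpleModule B (B ⧸ Ring.jacobson B)]
    (h : Subsingleton (Abelian.Ext.{u} (ModuleCat.of B (B ⧸ Ring.jacobson B)) M i))
    (N : Type u) [AddCommGroup N] [Module B N] [IsSimpleModule B N] :
    Subsingleton (Abelian.Ext.{u} (ModuleCat.of B N) M i) := by
  obtain ⟨K, hK, ⟨e⟩⟩ := (isSimpleModule_iff_quot_maximal (R := B) (M := N)).1 inferInstance
  let p : (B ⧸ Ring.jacobson B) →ₗ[B] N :=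
    e.symm.toLinearMap ∘ₗ Submodule.factor (Ring.jacobson_le_of_isMaximal K)
  have hp : Function.Surjective p := e.symm.surjective.comp (Submodule.factor_surjective _)
  obtain ⟨s, hs⟩ := IsSemisimpleModule.lifting_property p hp LinearMap.id
  exact subsingleton_ext_of_leftInverse s p hs M i h

theorem subsingleton_ext_of_isFiniteLength
    (h : ∀ (N : Type u) [AddCommGroup N] [Module B N] [IsSimpleModule B N],
      Subsingleton (Abelian.Ext.{u} (ModuleCat.of B N) M i))
    {N : Type u} [AddCommGroup N] [Module B N] (hN : IsFiniteLength B N) :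
    Subsingleton (Abelian.Ext.{u} (ModuleCat.of B N) M i) := by
  induction hN with
  | of_subsingleton => exact subsingleton_ext_of_subsingleton _ M i
  | of_simple_quotient _ ih => exact subsingleton_ext_of_submodule_of_quotient _ M i ih (h _)

end ExtSimple

/-- If `Ext` from `B ⧸ rad B` to `M` vanishes in all degrees `> n`, then `M` has injective dimension
at most `n`. -/
theorem hasInjectiveDimensionLT_of_subsingleton_ext_jacobson (R : Type u) [CommRing R]
    [IsNoetherianRing R] [IsLocalRing R] {B : Type u} [Ring B] [Algebra R B] [Module.Finite R B]
    (M : ModuleCat.{u} B) [Module.Finite B M] (n : ℕ)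
    (h : ∀ i, n < i → Subsingleton
      (Abelian.Ext.{u} (ModuleCat.of B (B ⧸ Ring.jacobson B)) M i)) :
    HasInjectiveDimensionLT M (n + 1) := by
  have : IsNoetherianRing B := isNoetherian_of_tower R inferInstance
  have := isSemisimpleModule_quotient_ringJacobson R B
  refine hasInjectiveDimensionLT_of_subsingleton_ext_quotient M n fun I ↦
    subsingleton_ext_of_maximalIdeal (R := R) M n (fun N _ _ _ hN i hi ↦ ?_) _ _ n.lt_succ_self
  have := isArtinian_of_algebraMap_maximalIdeal_smul_eq_zero N hN
  exact subsingleton_ext_of_isFiniteLength M i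
    (fun S _ _ _ ↦ subsingleton_ext_of_isSimpleModule M i (h i hi) S)
    (isFiniteLength_iff_isNoetherian_isArtinian.2 ⟨inferInstance, this⟩)

/-- Let `R` be a commutative noetherian local ring and `A` a Noether
`R`-algebra.  Let `M` be a nonzero finitely generated right `A`-module.  Then the injective
dimension of `M` as a right `A`-module equals `sup { i | Ext^i_A(A/rad A, M) ≠ 0 }`
(an equality in `ℕ ∪ {∞}`). -/
theorem injectiveDimension_eq_sup_ext_jacobson
    (R : Type u) [CommRing R] [IsNoetherianRing R] [IsLocalRing R]
    (A : Type u) [Ring A] [Algebra R A] [Module.Finite R A]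
    (M : Type u) [AddCommGroup M] [Module Aᵐᵒᵖ M] [Module.Finite Aᵐᵒᵖ M]
    (hM : Nontrivial M) :
    injDim Aᵐᵒᵖ (ModuleCat.of Aᵐᵒᵖ M) =
      ⨆ i ∈ {i : ℕ | ¬ Subsingleton
        (extGrp Aᵐᵒᵖ i (ModuleCat.of Aᵐᵒᵖ (modRad A)) (ModuleCat.of Aᵐᵒᵖ M))}, (i : ℕ∞) := by
  refine le_antisymm ?_ (iSup₂_le fun i hi ↦ le_sInf fun d hd ↦ not_lt.1 fun h ↦ hi (hd i h _))
  generalize hs : (⨆ i ∈ {i : ℕ | ¬ Subsingleton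
    (extGrp Aᵐᵒᵖ i (ModuleCat.of Aᵐᵒᵖ (modRad A)) (ModuleCat.of Aᵐᵒᵖ M))}, (i : ℕ∞)) = s
  induction s using ENat.recTopCoe with
  | top => exact le_top
  | coe n =>
    have hinj : HasInjectiveDimensionLT (ModuleCat.of Aᵐᵒᵖ M) (n + 1) := by
      refine hasInjectiveDimensionLT_of_subsingleton_ext_jacobson R _ n fun i hi ↦ ?_
      rw [← radRight_eq_ringJacobson, ← subsingleton_leftDerivedExt_iff _ _ (by lia)]
      by_contra hne
      exact (Nat.cast_lt.2 hi).not_ge (hs ▸ le_iSup₂_of_le i hne le_rfl)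
    refine sInf_le fun i hi N ↦ ?_
    have hi' : n < i := Nat.cast_lt.1 hi
    exact (subsingleton_leftDerivedExt_iff N _ (by lia)).2
      (HasInjectiveDimensionLT.subsingleton (ModuleCat.of Aᵐᵒᵖ M) (n + 1) i hi' N)
end

section
/- Let R be a commutative noetherian local ring that is complete with respect to its maximal-ideal-adic topology, and let A be a Noether R-algebra. Then every indecomposable finitely generated right A-module has local endomorphism ring; that is, if M is a nonzero finitely generated right A-module that is not the direct sum of two nonzero submodules, then End_A(M) is a local ring (the non-invertible elements form a proper two-sided ideal). -/
universe v u

/-- A module is indecomposable if it is nonzero and is not the (internal) direct sum of two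
nonzero submodules. -/
def IsIndecomposableModule (B : Type*) [Ring B] (M : Type*) [AddCommGroup M]
    [Module B M] : Prop :=
  Nontrivial M ∧ ∀ P Q : Submodule B M, IsCompl P Q → P = ⊥ ∨ Q = ⊥

/-- A finite module over an `I`-adically complete ring is `I`-adically precomplete. -/
theorem IsPrecomplete.of_finite {R : Type*} [CommRing R] (I : Ideal R) [IsAdicComplete I R]
    (M : Type*) [AddCommGroup M] [Module R M] [Module.Finite R M] : IsPrecomplete I M := by
  rw [← AdicCompletion.of_surjective_iff]
  intro z
  obtain ⟨t, rfl⟩ := AdicCompletion.ofTensorProduct_surjective_of_finite I M z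
  induction t with
  | zero => exact ⟨0, by simp⟩
  | add s t hs ht =>
    obtain ⟨x, hx⟩ := hs
    obtain ⟨y, hy⟩ := ht
    exact ⟨x + y, by rw [map_add, map_add, hx, hy]⟩
  | tmul a x =>
    obtain ⟨r, rfl⟩ := AdicCompletion.of_surjective I R a
    refine ⟨r • x, ?_⟩
    rw [AdicCompletion.ofTensorProduct_tmul, map_smul]
    rfl

/-- If `S` is Henselian at `J` with `S ⧸ J` artinian, and `S` has only trivial idempotents,
then for every `x : S` either `x` or `1 - x` is a unit. -/
theorem HenselianRing.isUnit_or_isUnit_one_sub {S : Type*} [CommRing S] (J : Ideal S)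
    [HenselianRing S J] [IsArtinianRing (S ⧸ J)]
    (hS : ∀ e : S, IsIdempotentElem e → e = 0 ∨ e = 1) (x : S) :
    IsUnit x ∨ IsUnit (1 - x) := by
  have : IsLocalHom (Ideal.Quotient.mk J) := isLocalHom_of_le_jacobson_bot J HenselianRing.jac
  set q := Ideal.Quotient.mk J
  obtain ⟨n, y, hy⟩ := IsArtinian.exists_pow_succ_smul_dvd (q x) (1 : S ⧸ J)
  obtain ⟨y, rfl⟩ := Ideal.Quotient.mk_surjective y
  change q x ^ (n + 1) * q y = q x ^ n * 1 at hy
  have hstep (k : ℕ) : q x ^ (n + 1) * (q x * q y) ^ k = q x ^ (n + 1) := by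
    induction k with
    | zero => simp
    | succ k ih =>
      calc q x ^ (n + 1) * (q x * q y) ^ (k + 1)
          = (q x ^ (n + 1) * (q x * q y) ^ k) * (q x * q y) := by ring
        _ = q x * (q x ^ (n + 1) * q y) := by rw [ih]; ring
        _ = q x ^ (n + 1) := by rw [hy]; ring
  have hidem : q ((x * y) ^ (n + 1)) * q ((x * y) ^ (n + 1)) = q ((x * y) ^ (n + 1)) := by
    calc q ((x * y) ^ (n + 1)) * q ((x * y) ^ (n + 1))
        = (q x ^ (n + 1) * (q x * q y) ^ (n + 1)) * q y ^ (n + 1) := by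
          simp only [map_pow, map_mul]; ring
      _ = q ((x * y) ^ (n + 1)) := by rw [hstep]; simp only [map_pow, map_mul]; ring
  obtain ⟨a, ha, haJ⟩ := HenselianRing.is_henselian (I := J)
    (Polynomial.X ^ 2 - Polynomial.X : Polynomial S)
    (Polynomial.monic_X_pow_sub (n := 2) (Polynomial.degree_X_le.trans_lt (by norm_num)))
    ((x * y) ^ (n + 1))
    (by
      rw [← Ideal.Quotient.eq_zero_iff_mem]
      change q _ = 0
      simp only [Polynomial.eval_sub, Polynomial.eval_pow, Polynomial.eval_X, map_sub]
      rw [pow_two, map_mul, hidem, sub_self])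
    (by
      refine IsUnit.of_mul_eq_one (q (2 * (x * y) ^ (n + 1) - 1)) ?_
      change q _ * _ = 1
      simp only [Polynomial.derivative_sub, Polynomial.derivative_X_pow, Polynomial.derivative_X,
        Polynomial.eval_sub, Polynomial.eval_mul, Polynomial.eval_pow, Polynomial.eval_X,
        Polynomial.eval_one, Polynomial.eval_C, map_sub q, map_mul q, map_one]
      norm_num
      simp only [map_pow, map_mul] at hidem
      rw [map_ofNat q 2]
      linear_combination 4 * hidem)
  have hqa : q a = q ((x * y) ^ (n + 1)) := Ideal.Quotient.eq.mpr haJ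
  have ha' : IsIdempotentElem a := by
    simpa [Polynomial.IsRoot, sub_eq_zero, pow_two, isIdempotentElem_iff] using ha
  rcases hS a ha' with rfl | rfl
  · right
    refine isUnit_of_map_unit q _ ?_
    rw [map_sub, map_one]
    refine IsNilpotent.isUnit_one_sub ⟨n + 1, ?_⟩
    rw [← hstep (n + 1), ← map_mul, ← map_pow q (x * y), ← hqa, map_zero, mul_zero]
  · left
    refine isUnit_of_map_unit q _ ?_
    rw [map_pow, map_mul, map_one] at hqa
    exact isUnit_of_mul_isUnit_left
      ((isUnit_pow_iff n.succ_ne_zero).mp (hqa ▸ isUnit_one))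

/-- In a finite commutative algebra with only trivial idempotents over a complete noetherian local
ring, one of `x`, `1 - x` is a unit for every `x`. -/
theorem isUnit_or_isUnit_one_sub_of_finite {R S : Type*} [CommRing R] [IsNoetherianRing R]
    [IsLocalRing R] [IsAdicComplete (IsLocalRing.maximalIdeal R) R] [CommRing S] [Algebra R S]
    [Module.Finite R S] (hS : ∀ e : S, IsIdempotentElem e → e = 0 ∨ e = 1) (x : S) :
    IsUnit x ∨ IsUnit (1 - x) := by
  let J := (IsLocalRing.maximalIdeal R).map (algebraMap R S)
  have := IsPrecomplete.of_finite (IsLocalRing.maximalIdeal R) S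
  have : IsAdicComplete J S := (IsAdicComplete.map_algebraMap_iff _ _).mpr {}
  have : Module.Finite (R ⧸ IsLocalRing.maximalIdeal R) (S ⧸ J) :=
    Module.Finite.of_restrictScalars_finite R _ _
  have : IsArtinianRing (R ⧸ IsLocalRing.maximalIdeal R) :=
    inferInstanceAs (IsArtinianRing (IsLocalRing.ResidueField R))
  have : IsArtinianRing (S ⧸ J) := IsArtinianRing.of_finite (R ⧸ IsLocalRing.maximalIdeal R) _
  exact HenselianRing.isUnit_or_isUnit_one_sub J hS x

/-- A nontrivial finite algebra with only trivial idempotents over a complete noetherian local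
ring is local. -/
theorem IsLocalRing.of_finite_of_isIdempotentElem {R E : Type*} [CommRing R] [IsNoetherianRing R]
    [IsLocalRing R] [IsAdicComplete (IsLocalRing.maximalIdeal R) R] [Ring E] [Nontrivial E]
    [Algebra R E] [Module.Finite R E] (hE : ∀ e : E, IsIdempotentElem e → e = 0 ∨ e = 1) :
    IsLocalRing E where
  isUnit_or_isUnit_of_add_one {f g} hfg := by
    let φ := Polynomial.aeval (R := R) f
    let ψ := Ideal.kerLiftAlg φ
    have hψ : Function.Injective ψ := Ideal.kerLiftAlg_injective φ
    have : Module.Finite R (Polynomial R ⧸ RingHom.ker φ) :=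
      Module.Finite.of_injective ψ.toLinearMap hψ
    let x : Polynomial R ⧸ RingHom.ker φ := Ideal.Quotient.mk _ Polynomial.X
    have hx : ψ x = f := (Ideal.kerLiftAlg_mk φ _).trans (Polynomial.aeval_X f)
    have hg : ψ (1 - x) = g := by rw [map_sub, map_one, hx, ← hfg, add_sub_cancel_left]
    rw [← hg, ← hx]
    refine (isUnit_or_isUnit_one_sub_of_finite (R := R) (fun e he ↦ ?_) x).imp
      (·.map ψ) (·.map ψ)
    refine (hE (ψ e) (he.map ψ)).imp (fun h ↦ hψ ?_) (fun h ↦ hψ ?_)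
    · rw [h, map_zero]
    · rw [h, map_one]

/-- Endomorphisms of an indecomposable module have only trivial idempotents. -/
theorem IsIndecomposableModule.eq_zero_or_eq_one {B M : Type*} [Ring B] [AddCommGroup M]
    [Module B M] (hM : IsIndecomposableModule B M) (e : Module.End B M)
    (he : IsIdempotentElem e) : e = 0 ∨ e = 1 := by
  refine (hM.2 _ _ (LinearMap.IsIdempotentElem.isCompl he)).imp LinearMap.range_eq_bot.mp
    fun h ↦ ?_
  ext x
  exact LinearMap.ker_eq_bot.mp h (LinearMap.congr_fun he x)

/-- The endomorphisms of a finite module over a finite algebra over a noetherian ring form a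
finite module. -/
theorem Module.Finite.end_of_finite (R B M : Type*) [CommRing R] [IsNoetherianRing R] [Ring B]
    [Algebra R B] [Module.Finite R B] [AddCommGroup M] [Module R M] [Module B M]
    [IsScalarTower R B M] [Module.Finite B M] : Module.Finite R (Module.End B M) := by
  have : Module.Finite R M := Module.Finite.trans B M
  exact Module.Finite.of_injective (LinearMap.restrictScalarsₗ R B M M R)
    (LinearMap.restrictScalars_injective R)

/-- Let `R` be a commutative noetherian local ring that is complete with respect
to its maximal-ideal-adic topology, and let `A` be a Noether `R`-algebra.  Then every
indecomposable finitely generated right `A`-module has local endomorphism ring. -/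
theorem endomorphismRing_isLocal_of_indecomposable
    (R : Type u) [CommRing R] [IsNoetherianRing R] [IsLocalRing R]
    [IsAdicComplete (IsLocalRing.maximalIdeal R) R]
    (A : Type u) [Ring A] [Algebra R A] [Module.Finite R A]
    (M : Type v) [AddCommGroup M] [Module Aᵐᵒᵖ M] [Module.Finite Aᵐᵒᵖ M]
    (hM : IsIndecomposableModule Aᵐᵒᵖ M) :
    IsLocalRing (Module.End Aᵐᵒᵖ M) := by
  let _ : Module R M := Module.compHom M (algebraMap R Aᵐᵒᵖ)
  have : IsScalarTower R Aᵐᵒᵖ M := ⟨fun r a m ↦ by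
    rw [Algebra.smul_def, mul_smul]
    rfl⟩
  have := Module.Finite.end_of_finite R Aᵐᵒᵖ M
  have := hM.1
  exact IsLocalRing.of_finite_of_isIdempotentElem (R := R) hM.eq_zero_or_eq_one
end
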